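/- arXiv:math/0004137 — 2 statements merged into one kernel-verified Lean document; each statement's English description precedes it below -/
import Mathlib

section
/- (Removing a small entry from a shared box) Let T be a set-valued tableau whose shape is a partition λ, having at least one shared box (a box whose set has at least two elements), and let y be the smallest integer contained in a shared box of T. Suppose v is a finite sequence of positive integers such that the concatenation w(T)∘v is a reverse lattice word. Then there exist an integer x ≤ y and a set-valued tableau T̃ of shape λ such that w(T̃)∘v is a reverse lattice word and the content of the sequence (x)∘w(T̃) equals the content of w(T). -/
open MvPolynomial

/-- A set-valued tableau on an arbitrary finite set of boxes `(row, column)`.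
Entries are `0`-based: the entry `i : ℕ` stands for the integer `i + 1`
(equivalently, for the variable `x_{i+1}`).  Rows weakly increase from left to
right and columns strictly increase from top to bottom, expressed via
horizontally and vertically adjacent boxes. -/
structure SVT (cells : Finset (ℕ × ℕ)) where
  entry : ℕ × ℕ → Finset ℕ
  nonempty_of_mem : ∀ c ∈ cells, (entry c).Nonempty
  eq_empty_of_not_mem : ∀ c, c ∉ cells → entry c = ∅
  row_weak : ∀ i j, (i, j) ∈ cells → (i, j + 1) ∈ cells →
    ∀ a ∈ entry (i, j), ∀ b ∈ entry (i, j + 1), a ≤ b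
  col_strict : ∀ i j, (i, j) ∈ cells → (i + 1, j) ∈ cells →
    ∀ a ∈ entry (i, j), ∀ b ∈ entry (i + 1, j), a < b

namespace SVT

variable {cells : Finset (ℕ × ℕ)}

/-- `|T|`: the total number of integers in the boxes of `T`. -/
def size (T : SVT cells) : ℕ := ∑ c ∈ cells, (T.entry c).card

/-- `T` has all its entries among `{1, …, m}` (i.e. `0`-based entries `< m`). -/
def Bounded (T : SVT cells) (m : ℕ) : Prop := ∀ c, ∀ x ∈ T.entry c, x < m

/-- The monomial `x^T`, where the exponent of the variable `i` is the number of
boxes of `T` containing `i`. -/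
noncomputable def monomial (T : SVT cells) : MvPolynomial ℕ ℤ :=
  ∏ c ∈ cells, ∏ i ∈ T.entry c, X i

/-- The column word of `T`: columns are read from left to right, each column
from bottom to top, the integers within a box in increasing order. -/
def word (T : SVT cells) : List ℕ :=
  (List.range ((cells.sup fun c => max c.1 c.2) + 1)).flatMap fun j =>
    ((List.range ((cells.sup fun c => max c.1 c.2) + 1)).reverse).flatMap fun i =>
      (T.entry (i, j)).sort (· ≤ ·)

end SVT

/-- The stable Grothendieck polynomial of the shape given by `cells`, in the
variables `x_1, …, x_m` (`0`-based: variables `0, …, m-1`):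
`G(cells) = ∑_T (-1)^(|T| - #cells) x^T` over set-valued tableaux `T` of shape
`cells` with entries in `{1, …, m}`. -/
noncomputable def grothendieck (cells : Finset (ℕ × ℕ)) (m : ℕ) : MvPolynomial ℕ ℤ :=
  ∑ᶠ (T : SVT cells) (_ : T.Bounded m), ((-1 : ℤ) ^ (T.size - cells.card)) • T.monomial

/-- A reverse lattice word: every suffix contains, for each `i`, at least as
many occurrences of `i` as of `i + 1`. -/
def IsRLW (w : List ℕ) : Prop := ∀ s, s <:+ w → ∀ i, s.count (i + 1) ≤ s.count i

/-- A partial reverse lattice word with respect to the (`0`-based, half-open)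
interval `[a, b)`:  every suffix contains, for each `t` with `a ≤ t` and
`t + 1 < b`, at least as many occurrences of `t` as of `t + 1`. -/
def IsPartialRLW (a b : ℕ) (w : List ℕ) : Prop :=
  ∀ s, s <:+ w → ∀ t, a ≤ t → t + 1 < b → s.count (t + 1) ≤ s.count t

/-- `w` has content `ν`: the number of occurrences of `i` in `w` is the length
of the `i`-th row of `ν`. -/
def HasContent (w : List ℕ) (nu : YoungDiagram) : Prop := ∀ i, w.count i = nu.rowLen i

/-- The cells of the skew diagram `λ * μ`, obtained by placing `λ` and `μ`
corner to corner: `λ` occupies rows `0, …, ℓ(λ)-1` shifted right by `μ₁`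
columns, and `μ` occupies the rows below row `ℓ(λ)-1`. -/
def starCells (lam mu : YoungDiagram) : Finset (ℕ × ℕ) :=
  (lam.cells.image fun c => (c.1, c.2 + mu.rowLen 0)) ∪
    (mu.cells.image fun c => (c.1 + lam.colLen 0, c.2))

/-- The structure constant `c^ν_{λμ}`: `(-1)^(|ν|-|λ|-|μ|)` times the number of
set-valued tableaux of shape `λ * μ` whose word is a reverse lattice word with
content `ν`. -/
noncomputable def cLR (lam mu nu : YoungDiagram) : ℤ :=
  (-1 : ℤ) ^ (nu.card - lam.card - mu.card) *
    (Nat.card {T : SVT (starCells lam mu) // IsRLW T.word ∧ HasContent T.word nu} : ℤ)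

/-- The coproduct structure constant `d^ν_{λμ}`: `(-1)^(|λ|+|μ|-|ν|)` times the
number of set-valued tableaux of shape `ν` whose word is a partial reverse
lattice word with respect to both intervals `[1, ℓ(λ)]` and
`[ℓ(λ)+1, ℓ(λ)+ℓ(μ)]` and has content `(λ₁, …, λ_{ℓ(λ)}, μ₁, …, μ_{ℓ(μ)})`. -/
noncomputable def dCoeff (lam mu nu : YoungDiagram) : ℤ :=
  (-1 : ℤ) ^ (lam.card + mu.card - nu.card) *
    (Nat.card {T : SVT nu.cells //
      IsPartialRLW 0 (lam.colLen 0) T.word ∧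
      IsPartialRLW (lam.colLen 0) (lam.colLen 0 + mu.colLen 0) T.word ∧
      ∀ i, T.word.count i =
        if i < lam.colLen 0 then lam.rowLen i else mu.rowLen (i - lam.colLen 0)} : ℤ)

/-- The coefficient `α_{θ,μ}` for a shape `θ` given by `cells`:
`(-1)^(|μ|-|θ|)` times the number of set-valued tableaux of shape `θ` whose
word is a reverse lattice word with content `μ`. -/
noncomputable def alphaCoeff (cells : Finset (ℕ × ℕ)) (mu : YoungDiagram) : ℤ :=
  (-1 : ℤ) ^ (mu.card - cells.card) *
    (Nat.card {T : SVT cells // IsRLW T.word ∧ HasContent T.word mu} : ℤ)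

/-- `ν/λ` is a vertical strip: at most one box in each row. -/
def IsVerticalStrip (lam nu : YoungDiagram) : Prop := ∀ i, nu.rowLen i ≤ lam.rowLen i + 1

/-- `ν/λ` is a horizontal strip: at most one box in each column. -/
def IsHorizontalStrip (lam nu : YoungDiagram) : Prop := ∀ j, nu.colLen j ≤ lam.colLen j + 1

/-- A set of boxes is a rook strip if it has at most one box in each row and in
each column. -/
def IsRookStripCells (s : Finset (ℕ × ℕ)) : Prop :=
  (∀ i, (s.filter fun c => c.1 = i).card ≤ 1) ∧ (∀ j, (s.filter fun c => c.2 = j).card ≤ 1)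

/-- The rectangular Young diagram with `p` rows and `q` columns. -/
def rect (p q : ℕ) : YoungDiagram :=
  ⟨Finset.range p ×ˢ Finset.range q, by
    intro a b hba ha
    simp only [Finset.coe_product, Set.mem_prod, Finset.mem_coe, Finset.mem_range] at ha ⊢
    exact ⟨lt_of_le_of_lt hba.1 ha.1, lt_of_le_of_lt hba.2 ha.2⟩⟩

/-- The position of a box in the column word read backwards: a smaller key is read earlier. -/
def readKey (c : ℕ × ℕ) : ℕᵒᵈ ×ₗ ℕ := toLex (OrderDual.toDual c.2, c.1)

lemma readKey_lt_iff {c d : ℕ × ℕ} :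
    readKey c < readKey d ↔ d.2 < c.2 ∨ c.2 = d.2 ∧ c.1 < d.1 := by
  simp [readKey, Prod.Lex.toLex_lt_toLex]

lemma readKey_injective : Function.Injective readKey := by
  rintro ⟨a, b⟩ ⟨c, d⟩ h
  have := toLex.injective h
  simp only [Prod.mk.injEq, OrderDual.toDual_inj] at this
  simp [this]

/-- Starting from multiplicities `m`, the number of letters `k` read strictly before the box `p`
when each box `c ∈ S` contributes `f c k` letters `k`. -/
def readCount (S : Finset (ℕ × ℕ)) (m : ℕ → ℕ) (f : ℕ × ℕ → ℕ → ℕ) (p : ℕ × ℕ) (k : ℕ) : ℕ :=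
  m k + ∑ c ∈ S with readKey c < readKey p, f c k

/-- The reverse lattice condition in terms of multiplicities of letters in boxes. -/
def IsLattice (S : Finset (ℕ × ℕ)) (m : ℕ → ℕ) (f : ℕ × ℕ → ℕ → ℕ) : Prop :=
  ∀ p ∈ S, ∀ a, readCount S m f p (a + 1) + f p (a + 1) ≤ readCount S m f p a

/-- The multiplicity function of a single letter `z` in the box `b`. -/
def letterAt (b : ℕ × ℕ) (z : ℕ) (c : ℕ × ℕ) (k : ℕ) : ℕ := if c = b ∧ k = z then 1 else 0

lemma sum_letterAt {S : Finset (ℕ × ℕ)} {b : ℕ × ℕ} (hb : b ∈ S) (z k : ℕ) :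
    ∑ c ∈ S, letterAt b z c k = if k = z then 1 else 0 := by
  simp [letterAt, ite_and, hb]

section readCount

variable {S : Finset (ℕ × ℕ)} {m : ℕ → ℕ} {f : ℕ × ℕ → ℕ → ℕ}

lemma readCount_add_letterAt {b : ℕ × ℕ} (hb : b ∈ S) (z : ℕ) (p : ℕ × ℕ) (k : ℕ) :
    readCount S m (f + letterAt b z) p k =
      readCount S m f p k + if k = z ∧ readKey b < readKey p then 1 else 0 := by
  simp only [readCount, Pi.add_apply, Finset.sum_add_distrib, ← add_assoc]
  congr 1
  simp only [letterAt, ite_and, Finset.sum_ite_eq', Finset.mem_filter, hb, true_and]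
  split_ifs <;> rfl

lemma readCount_add_le {p q : ℕ × ℕ} (hp : p ∈ S) (h : readKey p < readKey q) (k : ℕ) :
    readCount S m f p k + f p k ≤ readCount S m f q k := by
  have : insert p (S.filter fun c => readKey c < readKey p) ⊆
      S.filter fun c => readKey c < readKey q := by
    intro c hc
    simp only [Finset.mem_insert, Finset.mem_filter] at hc ⊢
    rcases hc with rfl | hc
    · exact ⟨hp, h⟩
    · exact ⟨hc.1, hc.2.trans h⟩
  have h2 := Finset.sum_le_sum_of_subset (f := fun c => f c k) this
  rw [Finset.sum_insert (by simp)] at h2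
  simp only [readCount]
  omega

/-- Reading one more box down a column. -/
lemma readCount_succ {i j : ℕ} (h : (i, j) ∈ S) (k : ℕ) :
    readCount S m f (i + 1, j) k = readCount S m f (i, j) k + f (i, j) k := by
  have : (S.filter fun c => readKey c < readKey (i + 1, j)) =
      insert (i, j) (S.filter fun c => readKey c < readKey (i, j)) := by
    ext c
    simp only [Finset.mem_insert, Finset.mem_filter, readKey_lt_iff]
    constructor
    · rintro ⟨hc, h1⟩
      by_cases h2 : c = (i, j)
      · exact Or.inl h2
      · refine Or.inr ⟨hc, ?_⟩
        rw [Prod.ext_iff] at h2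
        simp only at h1 h2 ⊢
        omega
    · rintro (rfl | ⟨hc, h1⟩)
      · exact ⟨h, by simp⟩
      · exact ⟨hc, by omega⟩
  rw [readCount, readCount, this, Finset.sum_insert (by simp)]
  omega

/-- The lattice inequality at `q` only has to be checked at the letters `k + 1` read so far. -/
lemma readCount_succ_le_of_forall {k : ℕ} (hm : m (k + 1) ≤ m k)
    (hf : ∀ c, f c (k + 1) ≤ 1) {q : ℕ × ℕ} (hq : f q (k + 1) ≠ 0 → q ∈ S)
    (h : ∀ r ∈ S, readKey r ≤ readKey q → f r (k + 1) ≠ 0 →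
      readCount S m f r (k + 1) < readCount S m f r k) :
    readCount S m f q (k + 1) + f q (k + 1) ≤ readCount S m f q k := by
  by_cases hq0 : f q (k + 1) = 0
  swap
  · have := h q (hq hq0) le_rfl hq0
    have := hf q
    omega
  rw [hq0, add_zero]
  by_cases hne : ((S.filter fun c => readKey c < readKey q).filter
      fun c => f c (k + 1) ≠ 0).Nonempty
  · obtain ⟨r, hr, hmax⟩ := Finset.exists_max_image _ readKey hne
    simp only [Finset.mem_filter] at hr hmax
    have h1 := h r hr.1.1 hr.1.2.le hr.2
    have h2 : readCount S m f r k ≤ readCount S m f q k :=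
      le_trans (Nat.le_add_right _ _) (readCount_add_le hr.1.1 hr.1.2 k)
    have h3 : readCount S m f q (k + 1) ≤ readCount S m f r (k + 1) + f r (k + 1) := by
      have : ∑ c ∈ S with readKey c < readKey q, f c (k + 1) ≤
          ∑ c ∈ insert r (S.filter fun c => readKey c < readKey r), f c (k + 1) := by
        refine Finset.sum_le_sum_of_ne_zero fun c hc hc0 => ?_
        simp only [Finset.mem_filter] at hc
        rcases (hmax c ⟨hc, hc0⟩).lt_or_eq with h4 | h4
        · simp [hc.1, h4]
        · simp [readKey_injective h4]
      rw [Finset.sum_insert (by simp)] at this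
      simp only [readCount]
      omega
    have := hf r
    omega
  · rw [Finset.not_nonempty_iff_eq_empty, Finset.filter_eq_empty_iff] at hne
    have : ∑ c ∈ S with readKey c < readKey q, f c (k + 1) = 0 :=
      Finset.sum_eq_zero fun c hc => not_not.mp (hne hc)
    simp only [readCount, this]
    omega

lemma readCount_of_subset {S' : Finset (ℕ × ℕ)} (h : S ⊆ S') (hf : ∀ c ∉ S, ∀ k, f c k = 0) :
    readCount S' m f = readCount S m f := by
  funext p k
  simp only [readCount, Finset.sum_filter]
  rw [Finset.sum_subset h]
  intro c _ hc
  simp [hf c hc]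

end readCount

lemma IsRLW.of_append {u w : List ℕ} (h : IsRLW (u ++ w)) : IsRLW w :=
  fun s hs => h s (hs.trans (List.suffix_append u w))

/-- The lattice condition for a word beginning with the letters of one box. -/
lemma isRLW_sort_append_iff (s : Finset ℕ) (w : List ℕ) :
    IsRLW (s.sort (· ≤ ·) ++ w) ↔
      IsRLW w ∧ ∀ a, w.count (a + 1) + (if a + 1 ∈ s then 1 else 0) ≤ w.count a := by
  constructor
  · intro h
    refine ⟨h.of_append, fun a => ?_⟩
    split_ifs with ha
    swap
    · exact h.of_append w List.suffix_rfl a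
    have hmem : a + 1 ∈ s.sort (· ≤ ·) := (Finset.mem_sort _).2 ha
    obtain ⟨l₁, l₂, hl⟩ := List.append_of_mem hmem
    have hsuf : (a + 1) :: l₂ ++ w <:+ s.sort (· ≤ ·) ++ w := by
      rw [hl, List.append_assoc]; exact List.suffix_append _ _
    have h1 := h _ hsuf a
    have hs := Finset.pairwise_sort s (· ≤ ·)
    rw [hl, List.pairwise_append, List.pairwise_cons] at hs
    have h2 : a ∉ l₂ := fun h3 => by
      have := hs.2.1.1 a h3
      omega
    simp only [List.cons_append, List.count_cons, List.count_append,
      List.count_eq_zero_of_not_mem h2] at h1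
    simp at h1
    omega
  · rintro ⟨hw, h⟩ t ht a
    obtain ht | ⟨l, rfl, hl⟩ : t <:+ w ∨ ∃ l, t = l ++ w ∧ l <:+ s.sort (· ≤ ·) := by
      obtain ⟨r, hr⟩ := ht
      rw [List.append_eq_append_iff] at hr
      grind [List.IsSuffix]
    · exact hw t ht a
    · rw [List.count_append, List.count_append]
      have h1 : l.count (a + 1) ≤ if a + 1 ∈ s then 1 else 0 := by
        refine (hl.sublist.count_le _).trans ?_
        rw [List.Nodup.count (Finset.sort_nodup _ _)]
        simp
      have := h a
      omega

namespace SVT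

/-- The multiplicity of `k` in the box `c`. -/
def mult {cells : Finset (ℕ × ℕ)} (T : SVT cells) (c : ℕ × ℕ) (k : ℕ) : ℕ :=
  if k ∈ T.entry c then 1 else 0

end SVT

lemma count_flatMap_sort (g : ℕ × ℕ → Finset ℕ) {L : List (ℕ × ℕ)} (hL : L.Nodup) (k : ℕ) :
    (L.flatMap fun c => (g c).sort (· ≤ ·)).count k =
      ∑ c ∈ L.toFinset, if k ∈ g c then 1 else 0 := by
  rw [List.count_flatMap, List.sum_toFinset _ hL]
  congr 1
  refine List.map_congr_left fun c _ => ?_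
  simp [Function.comp, List.Nodup.count (Finset.sort_nodup _ _)]

lemma isRLW_flatMap_append_iff (g : ℕ × ℕ → Finset ℕ) (v : List ℕ) {L : List (ℕ × ℕ)}
    (hL : L.Pairwise fun c d => readKey d < readKey c) :
    IsRLW ((L.flatMap fun c => (g c).sort (· ≤ ·)) ++ v) ↔
      IsRLW v ∧ IsLattice L.toFinset (fun k => v.count k)
        (fun c k => if k ∈ g c then 1 else 0) := by
  induction L with
  | nil => simp [IsLattice]
  | cons p L ih =>
    rw [List.pairwise_cons] at hL
    have hnd : L.Nodup := hL.2.imp fun h e => by simp [e] at h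
    have hp : ∀ k, readCount (p :: L).toFinset (fun k => v.count k)
        (fun c k => if k ∈ g c then 1 else 0) p k =
        ((L.flatMap fun c => (g c).sort (· ≤ ·)) ++ v).count k := by
      intro k
      have : ((p :: L).toFinset.filter fun c => readKey c < readKey p) = L.toFinset := by
        ext c
        simp only [Finset.mem_filter, List.mem_toFinset, List.mem_cons]
        constructor
        · rintro ⟨rfl | h, h'⟩
          · simp at h'
          · exact h
        · exact fun h => ⟨Or.inr h, hL.1 c h⟩
      rw [readCount, this, List.count_append, count_flatMap_sort g hnd, add_comm]
    have hq : ∀ q ∈ L, ∀ k, readCount (p :: L).toFinset (fun k => v.count k)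
        (fun c k => if k ∈ g c then 1 else 0) q k =
        readCount L.toFinset (fun k => v.count k) (fun c k => if k ∈ g c then 1 else 0) q k := by
      intro q hq k
      have : ((p :: L).toFinset.filter fun c => readKey c < readKey q) =
          L.toFinset.filter fun c => readKey c < readKey q := by
        rw [List.toFinset_cons, Finset.filter_insert, if_neg (hL.1 q hq).not_gt]
      rw [readCount, this, readCount]
    rw [List.flatMap_cons, List.append_assoc, isRLW_sort_append_iff, ih hL.2, and_assoc]
    refine and_congr_right fun _ => ?_
    simp only [IsLattice, List.mem_toFinset, List.forall_mem_cons, hp]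
    rw [and_comm]
    refine and_congr_right fun _ => forall₂_congr fun q hqL => ?_
    simp only [hq q hqL]

/-- The boxes of the square of side `n`, in the order used by the column word. -/
def columnBoxes (n : ℕ) : List (ℕ × ℕ) :=
  (List.range n).flatMap fun j => (List.range n).reverse.map fun i => (i, j)

lemma pairwise_columnBoxes (n : ℕ) :
    (columnBoxes n).Pairwise fun c d => readKey d < readKey c := by
  rw [columnBoxes, List.pairwise_flatMap]
  constructor
  · intro j _
    rw [List.pairwise_map, List.pairwise_reverse]
    exact List.pairwise_lt_range.imp fun h => by simp [readKey_lt_iff, h]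
  · refine List.pairwise_lt_range.imp fun h c hc d hd => ?_
    simp only [List.mem_map] at hc hd
    obtain ⟨_, _, rfl⟩ := hc
    obtain ⟨_, _, rfl⟩ := hd
    simp [readKey_lt_iff, h]

namespace SVT

section word

variable {cells : Finset (ℕ × ℕ)} (T : SVT cells)

lemma word_eq_flatMap_columnBoxes :
    T.word = (columnBoxes ((cells.sup fun c => max c.1 c.2) + 1)).flatMap
      fun c => (T.entry c).sort (· ≤ ·) := by
  simp only [word, columnBoxes, List.flatMap_assoc, List.flatMap_map]

lemma subset_columnBoxes :
    cells ⊆ (columnBoxes ((cells.sup fun c => max c.1 c.2) + 1)).toFinset := by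
  intro c hc
  have : max c.1 c.2 ≤ cells.sup fun c => max c.1 c.2 :=
    Finset.le_sup (f := fun c : ℕ × ℕ => max c.1 c.2) hc
  simp only [columnBoxes, List.mem_toFinset, List.mem_flatMap, List.mem_map, List.mem_reverse,
    List.mem_range]
  exact ⟨c.2, by omega, c.1, by omega, rfl⟩

lemma mult_eq_zero_of_not_mem {c : ℕ × ℕ} (hc : c ∉ cells) (k : ℕ) : T.mult c k = 0 := by
  simp [mult, T.eq_empty_of_not_mem c hc]

lemma mult_le_one (c : ℕ × ℕ) (k : ℕ) : T.mult c k ≤ 1 := by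
  simp only [mult]
  split_ifs <;> simp

lemma mem_cells {c : ℕ × ℕ} {a : ℕ} (h : a ∈ T.entry c) : c ∈ cells := by
  by_contra hc
  simp [T.eq_empty_of_not_mem c hc] at h

lemma count_word (k : ℕ) : T.word.count k = ∑ c ∈ cells, T.mult c k := by
  rw [word_eq_flatMap_columnBoxes, count_flatMap_sort _
    ((pairwise_columnBoxes _).imp fun h e => by simp [e] at h)]
  exact (Finset.sum_subset subset_columnBoxes fun c _ hc => T.mult_eq_zero_of_not_mem hc k).symm

lemma isRLW_word_append_iff (v : List ℕ) :
    IsRLW (T.word ++ v) ↔ IsRLW v ∧ IsLattice cells (fun k => v.count k) T.mult := by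
  rw [word_eq_flatMap_columnBoxes, isRLW_flatMap_append_iff _ _ (pairwise_columnBoxes _)]
  refine and_congr_right fun hv => ?_
  change IsLattice _ _ T.mult ↔ _
  rw [IsLattice, IsLattice, readCount_of_subset subset_columnBoxes
    fun c hc k => T.mult_eq_zero_of_not_mem hc k]
  refine ⟨fun h p hp => h p (subset_columnBoxes hp), fun h p _ a => ?_⟩
  refine readCount_succ_le_of_forall (hv v List.suffix_rfl a) (fun c => T.mult_le_one c _)
    (fun h0 => by_contra fun hp => h0 (T.mult_eq_zero_of_not_mem hp _)) fun r hr _ hr0 => ?_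
  have := h r hr a
  omega

end word

/-- Replacing the set in one box. -/
def replace {cells : Finset (ℕ × ℕ)} (T : SVT cells) (i j : ℕ) (s : Finset ℕ)
    (hc : (i, j) ∈ cells) (hs : s.Nonempty)
    (hleft : ∀ j', j' + 1 = j → ∀ a ∈ T.entry (i, j'), ∀ b ∈ s, a ≤ b)
    (hright : ∀ a ∈ s, ∀ b ∈ T.entry (i, j + 1), a ≤ b)
    (hup : ∀ i', i' + 1 = i → ∀ a ∈ T.entry (i', j), ∀ b ∈ s, a < b)
    (hdown : ∀ a ∈ s, ∀ b ∈ T.entry (i + 1, j), a < b) : SVT cells where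
  entry := Function.update T.entry (i, j) s
  nonempty_of_mem c h := by
    rw [Function.update_apply]
    split_ifs
    · exact hs
    · exact T.nonempty_of_mem c h
  eq_empty_of_not_mem c h := by
    rw [Function.update_of_ne (by rintro rfl; exact h hc)]
    exact T.eq_empty_of_not_mem c h
  row_weak i' j' h h' a ha b hb := by
    rw [Function.update_apply] at ha hb
    split_ifs at ha hb with h1 h2 h2 <;> simp only [Prod.mk.injEq] at h1 h2
    · omega
    · obtain ⟨rfl, rfl⟩ := h1
      exact hright a ha b hb
    · obtain ⟨rfl, h2⟩ := h2
      exact hleft j' h2 a ha b hb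
    · exact T.row_weak i' j' h h' a ha b hb
  col_strict i' j' h h' a ha b hb := by
    rw [Function.update_apply] at ha hb
    split_ifs at ha hb with h1 h2 h2 <;> simp only [Prod.mk.injEq] at h1 h2
    · omega
    · obtain ⟨rfl, rfl⟩ := h1
      exact hdown a ha b hb
    · obtain ⟨h2, rfl⟩ := h2
      exact hup i' h2 a ha b hb
    · exact T.col_strict i' j' h h' a ha b hb

variable {lam : YoungDiagram} (T : SVT lam.cells)

lemma le_of_row {i j j' a b : ℕ} (h : j < j') (ha : a ∈ T.entry (i, j))
    (hb : b ∈ T.entry (i, j')) : a ≤ b := by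
  induction j', h using Nat.le_induction generalizing b with
  | base => exact T.row_weak i j (T.mem_cells ha) (T.mem_cells hb) a ha b hb
  | succ n hn ih =>
    have hmem : (i, n) ∈ lam.cells :=
      lam.up_left_mem le_rfl n.le_succ (T.mem_cells hb)
    obtain ⟨e, he⟩ := T.nonempty_of_mem _ hmem
    exact (ih he).trans (T.row_weak i n hmem (T.mem_cells hb) e he b hb)

lemma lt_of_col {i i' j a b : ℕ} (h : i < i') (ha : a ∈ T.entry (i, j))
    (hb : b ∈ T.entry (i', j)) : a < b := by
  induction i', h using Nat.le_induction generalizing b with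
  | base => exact T.col_strict i j (T.mem_cells ha) (T.mem_cells hb) a ha b hb
  | succ n hn ih =>
    have hmem : (n, j) ∈ lam.cells :=
      lam.up_left_mem n.le_succ le_rfl (T.mem_cells hb)
    obtain ⟨e, he⟩ := T.nonempty_of_mem _ hmem
    exact (ih he).trans (T.col_strict n j hmem (T.mem_cells hb) e he b hb)

/-- If `T` becomes lattice after inserting `z` into the box `(i, j)`, then, under conditions on the
entries near that box, one can delete a letter `x ≤ z` from the content and stay lattice. -/
lemma exists_isLattice_of_add_letterAt (m : ℕ → ℕ) (hm : ∀ k, m (k + 1) ≤ m k) (z : ℕ) :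
    ∀ (T : SVT lam.cells) (i j : ℕ), (i, j) ∈ lam.cells →
    (∀ e ∈ T.entry (i, j), z < e) →
    (∀ j' < j, ∀ e ∈ T.entry (i, j'), e ≤ z) →
    (∀ i' > i, ∀ e ∈ T.entry (i', j), z + 1 < e) →
    (∀ c : ℕ × ℕ, c.2 < j → ∀ e ∈ T.entry c, e ≤ z → T.entry c = {e}) →
    IsLattice lam.cells m (T.mult + letterAt (i, j) z) →
    ∃ x ≤ z, ∃ T' : SVT lam.cells, IsLattice lam.cells m T'.mult ∧
      ∀ k, (∑ c ∈ lam.cells, T'.mult c k) + (if k = x then 1 else 0) =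
        (∑ c ∈ lam.cells, T.mult c k) + if k = z then 1 else 0 := by
  induction z using Nat.strong_induction_on with
  | _ z ih =>
  intro T i j hb hbz hleft hdown hsing hlat
  by_cases hT : IsLattice lam.cells m T.mult
  · exact ⟨z, le_rfl, T, hT, fun _ => rfl⟩
  have hne : ∀ q ∈ lam.cells, ∀ a, a ≠ z →
      readCount lam.cells m T.mult q (a + 1) + T.mult q (a + 1) ≤
        readCount lam.cells m T.mult q a := by
    intro q hq a ha
    have := hlat q hq a
    simp only [readCount_add_letterAt hb, Pi.add_apply, ha, false_and, if_false] at this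
    omega
  -- the first box where `z + 1` violates the lattice condition
  have hbad : (lam.cells.filter fun p => z + 1 ∈ T.entry p ∧
      readCount lam.cells m T.mult p z ≤ readCount lam.cells m T.mult p (z + 1)).Nonempty := by
    by_contra hempty
    rw [Finset.not_nonempty_iff_eq_empty, Finset.filter_eq_empty_iff] at hempty
    refine hT fun q hq a => ?_
    by_cases ha : a = z
    swap
    · exact hne q hq a ha
    subst ha
    refine readCount_succ_le_of_forall (hm a) (fun c => T.mult_le_one c _) (fun _ => hq) fun r hr _ hr0 => ?_
    have := hempty hr
    simp only [mult, ne_eq, ite_eq_right_iff, one_ne_zero, imp_false, not_not] at hr0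
    simpa [hr0] using this
  obtain ⟨⟨i', j'⟩, hp, hpmin⟩ := Finset.exists_min_image _ readKey hbad
  rw [Finset.mem_filter] at hp
  obtain ⟨hp, hpz, hpbad⟩ := hp
  have hgood : ∀ q ∈ lam.cells, readKey q < readKey (i', j') → ∀ a,
      readCount lam.cells m T.mult q (a + 1) + T.mult q (a + 1) ≤
        readCount lam.cells m T.mult q a := by
    intro q hq hqp a
    by_cases ha : a = z
    swap
    · exact hne q hq a ha
    subst ha
    refine readCount_succ_le_of_forall (hm a) (fun c => T.mult_le_one c _) (fun _ => hq) fun r hr hrq hr0 => ?_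
    simp only [mult, ne_eq, ite_eq_right_iff, one_ne_zero, imp_false, not_not] at hr0
    by_contra hcon
    have := hpmin r (by simp only [Finset.mem_filter]; exact ⟨hr, hr0, not_lt.mp hcon⟩)
    exact absurd (this.trans hrq) hqp.not_ge
  have hbp : readKey (i, j) < readKey (i', j') := by
    by_contra hcon
    have := hlat _ hp z
    simp only [readCount_add_letterAt hb, Pi.add_apply, hcon, and_false, if_false] at this
    have h1 : T.mult (i', j') (z + 1) = 1 := by simp [mult, hpz]
    omega
  have hj : j' < j := by
    rcases readKey_lt_iff.1 hbp with h | ⟨h, h'⟩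
    · exact h
    · simp only at h h'
      subst h
      exact absurd (hdown i' h' _ hpz) (lt_irrefl _)
  have hi : i < i' := by
    by_contra! hcon
    have hmem : (i, j') ∈ lam.cells := lam.up_left_mem le_rfl hj.le hb
    obtain ⟨e, he⟩ := T.nonempty_of_mem _ hmem
    have h1 := hleft j' hj e he
    rcases hcon.lt_or_eq with h | rfl
    · have := T.lt_of_col h hpz he
      omega
    · have := hleft j' hj _ hpz
      omega
  obtain ⟨i', rfl⟩ : ∃ n, i' = n + 1 := ⟨i' - 1, by omega⟩
  have hr : (i', j') ∈ lam.cells := lam.up_left_mem i'.le_succ le_rfl hp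
  have hpge : ∀ e ∈ T.entry (i' + 1, j'), z + 1 ≤ e := by
    intro e he
    by_contra! hcon
    rw [hsing _ hj e he (by omega), Finset.mem_singleton] at hpz
    omega
  have hrlt : ∀ e ∈ T.entry (i', j'), e < z := by
    intro e he
    have h1 := T.lt_of_col i'.lt_succ_self he hpz
    refine lt_of_le_of_ne (by omega) ?_
    rintro rfl
    have h2 := hgood _ hr (readKey_lt_iff.2 (Or.inr ⟨rfl, by simp⟩)) e
    rw [readCount_succ hr, readCount_succ hr] at hpbad
    have h3 : T.mult (i', j') e = 1 := by simp [mult, he]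
    omega
  -- the last box of the row above with an entry smaller than `z`
  obtain ⟨j₁, hb₁, ⟨u, hu, huz⟩, hj₁max⟩ : ∃ j₁, (i', j₁) ∈ lam.cells ∧
      (∃ e ∈ T.entry (i', j₁), e < z) ∧
      ∀ j₂, (∃ e ∈ T.entry (i', j₂), e < z) → j₂ ≤ j₁ := by
    have hrow : (lam.cells.filter fun c => c.1 = i' ∧ ∃ e ∈ T.entry c, e < z).Nonempty := by
      obtain ⟨e, he⟩ := T.nonempty_of_mem _ hr
      exact ⟨(i', j'), Finset.mem_filter.2 ⟨hr, rfl, e, he, hrlt e he⟩⟩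
    obtain ⟨⟨i₁, j₁⟩, hb₁, hmax⟩ := Finset.exists_max_image _ Prod.snd hrow
    obtain ⟨hmem, rfl, hu⟩ := Finset.mem_filter.1 hb₁
    exact ⟨j₁, hmem, hu, fun j₂ ⟨e, he, hez⟩ =>
      hmax (i₁, j₂) (Finset.mem_filter.2 ⟨T.mem_cells he, rfl, e, he, hez⟩)⟩
  have hj₁ : j' ≤ j₁ := by
    obtain ⟨e, he⟩ := T.nonempty_of_mem _ hr
    exact hj₁max _ ⟨e, he, hrlt e he⟩
  have hj₁j : j₁ < j := by
    by_contra! hcon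
    have hcol : ∀ e ∈ T.entry (i', j), z < e := by
      intro e he
      rcases (Nat.le_of_lt_succ hi).lt_or_eq with h | rfl
      · have := hdown i' h e he
        omega
      · exact hbz e he
    rcases hcon.lt_or_eq with h | rfl
    · obtain ⟨e, he⟩ := T.nonempty_of_mem _ (lam.up_left_mem le_rfl hcon hb₁)
      have h1 := hcol e he
      have h2 := T.le_of_row h he hu
      omega
    · have := hcol u hu
      omega
  have hbu : T.entry (i', j₁) = {u} := hsing _ hj₁j u hu huz.le
  have hbelow : ∀ e ∈ T.entry (i' + 1, j₁), z < e := by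
    intro e he
    rcases hj₁.lt_or_eq with h | rfl
    · exact T.le_of_row h hpz he
    · exact hpge e he
  let T₁ : SVT lam.cells := T.replace i' j₁ {z} hb₁ (Finset.singleton_nonempty z)
    (fun j₂ hj₂ a ha b hb' => by
      have := T.le_of_row (by omega) ha hu
      rw [Finset.mem_singleton] at hb'
      omega)
    (fun a ha b hb' => by
      rw [Finset.mem_singleton] at ha
      by_contra! hcon
      have := hj₁max (j₁ + 1) ⟨b, hb', by omega⟩
      omega)
    (fun i₂ hi₂ a ha b hb' => by
      have := T.lt_of_col (by omega) ha hu
      rw [Finset.mem_singleton] at hb'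
      omega)
    (fun a ha b hb' => by
      rw [Finset.mem_singleton] at ha
      exact ha ▸ hbelow b hb')
  have hT₁b : T₁.entry (i', j₁) = {z} := Function.update_self _ _ _
  have hT₁ : ∀ c, c ≠ (i', j₁) → T₁.entry c = T.entry c :=
    fun c hc => Function.update_of_ne hc _ _
  have hmult : T₁.mult + letterAt (i', j₁) u = T.mult + letterAt (i', j₁) z := by
    funext c k
    simp only [Pi.add_apply, mult, letterAt]
    by_cases hc : c = (i', j₁)
    · rw [hc, hT₁b, hbu]
      simp [add_comm]
    · simp [hT₁ c hc, hc]
  have hbb₁ : readKey (i, j) < readKey (i', j₁) := readKey_lt_iff.2 (Or.inl hj₁j)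
  have hb₁p : readKey (i', j₁) < readKey (i' + 1, j') := by
    rw [readKey_lt_iff]
    simp only
    omega
  obtain ⟨x, hx, T', hT', hcont⟩ := ih u huz T₁ i' j₁ hb₁
    (by simpa [hT₁b] using huz)
    (fun j₂ hj₂ e he => by
      rw [hT₁ _ (by simp only [ne_eq, Prod.mk.injEq]; omega)] at he
      exact T.le_of_row hj₂ he hu)
    (fun i₂ hi₂ e he => by
      rw [hT₁ _ (by simp only [ne_eq, Prod.mk.injEq]; omega)] at he
      rcases (Nat.succ_le_of_lt hi₂).lt_or_eq with h | rfl
      · obtain ⟨d, hd⟩ := T.nonempty_of_mem _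
          (lam.up_left_mem (Nat.succ_le_of_lt hi₂) le_rfl (T.mem_cells he))
        have h1 := hbelow d hd
        have h2 := T.lt_of_col h hd he
        omega
      · have := hbelow e he
        omega)
    (fun c hc e he heu => by
      have hne' : c ≠ (i', j₁) := by rintro rfl; exact lt_irrefl _ hc
      rw [hT₁ c hne'] at he ⊢
      exact hsing c (hc.trans hj₁j) e he (by omega))
    (by
      rw [hmult]
      intro q hq a
      have h1 := hlat q hq a
      simp only [readCount_add_letterAt hb, readCount_add_letterAt hb₁, Pi.add_apply,
        letterAt] at h1 ⊢
      rcases lt_trichotomy (readKey (i', j₁)) (readKey q) with h | h | h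
      · have hqb : q ≠ (i, j) := by rintro rfl; exact lt_asymm h hbb₁
        have hqb₁ : q ≠ (i', j₁) := by rintro rfl; exact lt_irrefl _ h
        simpa [h, hbb₁.trans h, hqb, hqb₁] using h1
      · obtain rfl := readKey_injective h
        have h2 := hgood _ hb₁ hb₁p a
        simp only [hbb₁, lt_irrefl, and_true, and_false, if_false, true_and, add_zero] at h1 ⊢
        by_cases haz : a + 1 = z
        · simp only [haz, if_true, show a ≠ z by omega, if_false] at h1 ⊢
          omega
        · simp only [haz, if_false]
          omega
      · have h2 := hgood q hq (h.trans hb₁p) a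
        have hqb₁ : q ≠ (i', j₁) := by rintro rfl; exact lt_irrefl _ h
        simpa [h.not_gt, hqb₁] using h2)
  refine ⟨x, hx.trans huz.le, T', hT', fun k => (hcont k).trans ?_⟩
  rw [← sum_letterAt hb₁, ← sum_letterAt hb₁, ← Finset.sum_add_distrib,
    ← Finset.sum_add_distrib]
  exact Finset.sum_congr rfl fun c _ => congrFun₂ hmult c k

end SVT

/-- **Removing a small entry from a shared box** (Lemma 7.6): let `T` be a
set-valued tableau whose shape is a partition `λ`, with at least one shared
box, `y` the smallest integer in a shared box of `T`, and `v` a sequence such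
that `w(T) ∘ v` is a reverse lattice word.  Then there are `x ≤ y` and a
tableau `T̃` of shape `λ` with `w(T̃) ∘ v` a reverse lattice word and the
content of `(x) ∘ w(T̃)` equal to that of `w(T)`. -/
theorem remove_small_shared_entry (lam : YoungDiagram) (T : SVT lam.cells) (y : ℕ)
    (hy : ∃ c ∈ lam.cells, 2 ≤ (T.entry c).card ∧ y ∈ T.entry c)
    (hymin : ∀ c ∈ lam.cells, 2 ≤ (T.entry c).card → ∀ z ∈ T.entry c, y ≤ z)
    (v : List ℕ) (hv : IsRLW (T.word ++ v)) :
    ∃ x, x ≤ y ∧ ∃ Tt : SVT lam.cells,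
      IsRLW (Tt.word ++ v) ∧ ∀ i, (x :: Tt.word).count i = T.word.count i := by
  obtain ⟨⟨i, j⟩, hc, hmin⟩ := Finset.exists_min_image
    (lam.cells.filter fun c => 2 ≤ (T.entry c).card ∧ y ∈ T.entry c) Prod.snd (by
      obtain ⟨c, hc⟩ := hy
      exact ⟨c, Finset.mem_filter.2 hc⟩)
  obtain ⟨hb, hcard, hyb⟩ := Finset.mem_filter.1 hc
  obtain ⟨hv', hlat⟩ := (T.isRLW_word_append_iff v).1 hv
  obtain ⟨u, hu, huy⟩ := Finset.exists_mem_ne hcard y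
  have hyu : y < u := lt_of_le_of_ne (hymin _ hb hcard u hu) huy.symm
  let T₁ : SVT lam.cells := T.replace i j ((T.entry (i, j)).erase y) hb
    ⟨u, Finset.mem_erase.2 ⟨huy, hu⟩⟩
    (fun j' hj' a ha b hb' => T.le_of_row (by omega) ha (Finset.mem_of_mem_erase hb'))
    (fun a ha b hb' => T.le_of_row (Nat.lt_succ_self j) (Finset.mem_of_mem_erase ha) hb')
    (fun i' hi' a ha b hb' => T.lt_of_col (by omega) ha (Finset.mem_of_mem_erase hb'))
    (fun a ha b hb' => T.lt_of_col (Nat.lt_succ_self i) (Finset.mem_of_mem_erase ha) hb')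
  have hT₁b : T₁.entry (i, j) = (T.entry (i, j)).erase y := Function.update_self _ _ _
  have hT₁ : ∀ c, c ≠ (i, j) → T₁.entry c = T.entry c :=
    fun c hc => Function.update_of_ne hc _ _
  have hmult : T₁.mult + letterAt (i, j) y = T.mult := by
    funext c k
    simp only [Pi.add_apply, SVT.mult, letterAt]
    by_cases hc : c = (i, j)
    · rw [hc, hT₁b]
      by_cases hk : k = y <;> simp [hk, hyb]
    · simp [hT₁ c hc, hc]
  obtain ⟨x, hx, T', hT', hcont⟩ := SVT.exists_isLattice_of_add_letterAt (fun k => v.count k)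
    (hv' v List.suffix_rfl) y T₁ i j hb
    (fun e he => by
      rw [hT₁b, Finset.mem_erase] at he
      exact lt_of_le_of_ne (hymin _ hb hcard e he.2) he.1.symm)
    (fun j' hj' e he => by
      rw [hT₁ _ (by simp only [ne_eq, Prod.mk.injEq]; omega)] at he
      exact T.le_of_row hj' he hyb)
    (fun i' hi' e he => by
      rw [hT₁ _ (by simp only [ne_eq, Prod.mk.injEq]; omega)] at he
      have := T.lt_of_col hi' hu he
      omega)
    (fun c hcj e he hey => by
      have hne : c ≠ (i, j) := by rintro rfl; exact lt_irrefl _ hcj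
      rw [hT₁ c hne] at he ⊢
      have hc1 : (T.entry c).card < 2 := by
        by_contra! hcon
        obtain rfl : e = y := le_antisymm hey (hymin c (T.mem_cells he) hcon e he)
        exact absurd (hmin c (Finset.mem_filter.2 ⟨T.mem_cells he, hcon, he⟩)) hcj.not_ge
      exact Finset.eq_singleton_iff_unique_mem.2
        ⟨he, fun d hd => Finset.card_le_one.1 (Nat.le_of_lt_succ hc1) d hd e he⟩)
    (by rwa [hmult])
  refine ⟨x, hx, T', (T'.isRLW_word_append_iff v).2 ⟨hv', hT'⟩, fun k => ?_⟩
  rw [List.count_cons, SVT.count_word, SVT.count_word, ← hmult]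
  simp only [Pi.add_apply, Finset.sum_add_distrib, sum_letterAt hb, ← hcont, beq_iff_eq,
    eq_comm (a := x)]
end

section
/- (Support bound for the structure constants) Let λ, μ, ν be partitions. If c^ν_{λμ} ≠ 0, then ν is contained in the union of all partitions ρ with |ρ| = |λ| + |μ| for which c^ρ_{λμ} ≠ 0 (these c^ρ_{λμ} with |ρ| = |λ|+|μ| are the classical Littlewood–Richardson coefficients); that is, every box of ν lies in some such partition ρ. -/
open MvPolynomial

section TableauWords

open Finset
open scoped Classical

/-- Letters `(box, value)` of a tableau, compared by their position in the column word. -/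
def ReadBefore (a b : (ℕ × ℕ) × ℕ) : Prop :=
  a.1.2 < b.1.2 ∨ (a.1.2 = b.1.2 ∧ (b.1.1 < a.1.1 ∨ (a.1.1 = b.1.1 ∧ a.2 < b.2)))

theorem ReadBefore.trans {a b c : (ℕ × ℕ) × ℕ} (hab : ReadBefore a b) (hbc : ReadBefore b c) :
    ReadBefore a c := by
  unfold ReadBefore at *; omega

theorem ReadBefore.irrefl (a : (ℕ × ℕ) × ℕ) : ¬ ReadBefore a a := by
  unfold ReadBefore; omega

/-- A set of letters closed under passing to later letters of the column word. -/
def IsFinalSegment (U : (ℕ × ℕ) × ℕ → Prop) : Prop := ∀ a b, ReadBefore a b → U a → U b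

/-- The letter `b` is `a` or comes after `a` in the column word. -/
def ReadFrom (a b : (ℕ × ℕ) × ℕ) : Prop := b = a ∨ ReadBefore a b

theorem isFinalSegment_readFrom (a : (ℕ × ℕ) × ℕ) : IsFinalSegment (ReadFrom a) := by
  rintro b c hbc (rfl | hab)
  · exact Or.inr hbc
  · exact Or.inr (hab.trans hbc)

theorem List.filter_suffix_of_pairwise {α : Type*} {R : α → α → Prop} {U : α → Prop}
    (hU : ∀ a b, R a b → U a → U b) {l : List α} (hl : l.Pairwise R) :
    l.filter (fun a => decide (U a)) <:+ l := by
  induction l with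
  | nil => simp
  | cons a l ih =>
    rw [List.pairwise_cons] at hl
    by_cases ha : U a
    · rw [List.filter_eq_self.2]
      intro b hb
      rcases List.mem_cons.1 hb with rfl | hb
      · simpa using ha
      · simpa using hU a b (hl.1 b hb) ha
    · rw [List.filter_cons_of_neg (by simpa using ha)]
      exact (ih hl.2).trans (List.suffix_cons a l)

namespace SVT

variable {cells : Finset (ℕ × ℕ)}

/-- The column word of `T` with each letter labelled by its box. -/
def labelledWord (T : SVT cells) : List ((ℕ × ℕ) × ℕ) :=
  (List.range ((cells.sup fun c => max c.1 c.2) + 1)).flatMap fun j =>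
    ((List.range ((cells.sup fun c => max c.1 c.2) + 1)).reverse).flatMap fun i =>
      ((T.entry (i, j)).sort (· ≤ ·)).map fun v => ((i, j), v)

theorem map_snd_labelledWord (T : SVT cells) : T.labelledWord.map Prod.snd = T.word := by
  simp [labelledWord, word, List.map_flatMap, Function.comp_def]

theorem mem_cells_of_mem_entry (T : SVT cells) {c : ℕ × ℕ} {x : ℕ} (hx : x ∈ T.entry c) :
    c ∈ cells := by
  by_contra hc
  simp [T.eq_empty_of_not_mem c hc] at hx

theorem mem_labelledWord (T : SVT cells) {b : (ℕ × ℕ) × ℕ} :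
    b ∈ T.labelledWord ↔ b.2 ∈ T.entry b.1 := by
  obtain ⟨⟨i, j⟩, v⟩ := b
  simp only [labelledWord, List.mem_flatMap, List.mem_range, List.mem_reverse, List.mem_map,
    Finset.mem_sort, Prod.mk.injEq]
  constructor
  · rintro ⟨j', -, i', -, v', hv, ⟨rfl, rfl⟩, rfl⟩
    exact hv
  · intro hv
    have h := Finset.le_sup (f := fun c : ℕ × ℕ => max c.1 c.2) (T.mem_cells_of_mem_entry hv)
    simp only [max_le_iff] at h
    exact ⟨j, by omega, i, by omega, v, hv, ⟨rfl, rfl⟩, rfl⟩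

theorem labelledWord_pairwise (T : SVT cells) : T.labelledWord.Pairwise ReadBefore := by
  unfold labelledWord
  rw [List.pairwise_flatMap]
  refine ⟨fun j _ => ?_, ?_⟩
  · rw [List.pairwise_flatMap]
    refine ⟨fun i _ => ?_, ?_⟩
    · rw [List.pairwise_map]
      refine (Finset.sortedLT_sort (T.entry (i, j))).pairwise.imp fun {a b} h => ?_
      exact Or.inr ⟨rfl, Or.inr ⟨rfl, h⟩⟩
    · rw [List.pairwise_reverse]
      refine List.pairwise_lt_range.imp fun {a b} h => ?_
      simp only [List.mem_map]
      rintro _ ⟨_, _, rfl⟩ _ ⟨_, _, rfl⟩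
      exact Or.inr ⟨rfl, Or.inl h⟩
  · refine List.pairwise_lt_range.imp fun {a b} h => ?_
    simp only [List.mem_flatMap, List.mem_map]
    rintro _ ⟨_, _, _, _, rfl⟩ _ ⟨_, _, _, _, rfl⟩
    exact Or.inl h

theorem labelledWord_nodup (T : SVT cells) : T.labelledWord.Nodup :=
  T.labelledWord_pairwise.imp fun {a b} (h : ReadBefore a b) (hab : a = b) =>
    ReadBefore.irrefl a (by rwa [← hab] at h)

theorem count_map_snd_filter (T : SVT cells) (U : (ℕ × ℕ) × ℕ → Prop) (x : ℕ) :
    ((T.labelledWord.filter fun a => decide (U a)).map Prod.snd).count x =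
      #{c ∈ cells | x ∈ T.entry c ∧ U (c, x)} := by
  rw [List.count_eq_countP, List.countP_map, List.countP_eq_length_filter,
    ← List.toFinset_card_of_nodup ((T.labelledWord_nodup.filter _).filter _)]
  symm
  refine Finset.card_bij (fun c _ => (c, x)) ?_ ?_ ?_
  · intro c hc
    simp only [Finset.mem_filter] at hc
    simp [T.mem_labelledWord, hc.2]
  · intro a _ b _ h
    simpa using h
  · rintro ⟨c, v⟩ hb
    simp only [List.mem_toFinset, List.mem_filter, T.mem_labelledWord, Function.comp_apply,
      beq_iff_eq, decide_eq_true_eq] at hb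
    obtain ⟨⟨h1, h2⟩, rfl⟩ := hb
    exact ⟨c, by simp [T.mem_cells_of_mem_entry h1, h1, h2], rfl⟩

theorem count_word_s18 (T : SVT cells) (x : ℕ) :
    T.word.count x = #{c ∈ cells | x ∈ T.entry c} := by
  simpa [map_snd_labelledWord] using T.count_map_snd_filter (fun _ => True) x

theorem isRLW_word_iff (T : SVT cells) :
    IsRLW T.word ↔ ∀ U, IsFinalSegment U → ∀ x,
      #{c ∈ cells | x + 1 ∈ T.entry c ∧ U (c, x + 1)} ≤
        #{c ∈ cells | x ∈ T.entry c ∧ U (c, x)} := by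
  constructor
  · intro h U hU x
    rw [← count_map_snd_filter, ← count_map_snd_filter]
    refine h _ ?_ x
    rw [← map_snd_labelledWord]
    exact (List.filter_suffix_of_pairwise hU T.labelledWord_pairwise).map _
  · intro h s hs x
    rw [← map_snd_labelledWord] at hs
    obtain ⟨s', hs', rfl⟩ := List.suffix_map_iff.1 hs
    obtain ⟨t, ht⟩ := hs'
    have hp := T.labelledWord_pairwise
    rw [← ht, List.pairwise_append] at hp
    obtain ⟨U, hU⟩ : ∃ U : (ℕ × ℕ) × ℕ → Prop,
        ∀ b, U b ↔ ∃ a ∈ s', ReadFrom a b := ⟨_, fun _ => Iff.rfl⟩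
    have hfilter : T.labelledWord.filter (fun b => decide (U b)) = s' := by
      rw [← ht, List.filter_append, List.filter_eq_nil_iff.2, List.nil_append,
        List.filter_eq_self]
      · intro b hb
        exact decide_eq_true ((hU b).2 ⟨b, hb, Or.inl rfl⟩)
      · intro b hb
        rw [decide_eq_true_eq, hU]
        rintro ⟨a, ha, rfl | hab⟩
        · exact ReadBefore.irrefl _ (hp.2.2 _ hb _ ha)
        · exact ReadBefore.irrefl _ ((hp.2.2 _ hb _ ha).trans hab)
    have := h U ?_ x
    · rwa [← T.count_map_snd_filter U, ← T.count_map_snd_filter U, hfilter] at this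
    · intro b c hbc hb
      rw [hU] at hb ⊢
      obtain ⟨a, ha, hab⟩ := hb
      exact ⟨a, ha, isFinalSegment_readFrom a b c hbc hab⟩

theorem entry_injective : Function.Injective (SVT.entry : SVT cells → _) := by
  rintro ⟨⟩ ⟨⟩ h
  cases h
  rfl

theorem finite_hasContent (nu : YoungDiagram) :
    Finite {T : SVT cells // IsRLW T.word ∧ HasContent T.word nu} := by
  have hlt : ∀ T : {T : SVT cells // IsRLW T.word ∧ HasContent T.word nu}, ∀ c,
      T.1.entry c ∈ (Finset.range (nu.colLen 0)).powerset := by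
    intro T c
    rw [Finset.mem_powerset]
    intro x hx
    have h := T.2.2 x
    rw [count_word_s18] at h
    have : 0 < nu.rowLen x := by
      rw [← h, Finset.card_pos]
      exact ⟨c, by simp [hx, T.1.mem_cells_of_mem_entry hx]⟩
    rw [← YoungDiagram.mem_iff_lt_rowLen, YoungDiagram.mem_iff_lt_colLen] at this
    simpa using this
  refine Finite.of_injective
    (β := cells → (Finset.range (nu.colLen 0)).powerset) (fun T c => ⟨T.1.entry c, hlt T c⟩) ?_
  intro T T' h
  refine Subtype.ext (entry_injective (funext fun c => ?_))
  by_cases hc : c ∈ cells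
  · simpa using congrFun h ⟨c, hc⟩
  · rw [T.1.eq_empty_of_not_mem c hc, T'.1.eq_empty_of_not_mem c hc]

end SVT

theorem cLR_ne_zero_iff {lam mu nu : YoungDiagram} :
    cLR lam mu nu ≠ 0 ↔
      ∃ T : SVT (starCells lam mu), IsRLW T.word ∧ HasContent T.word nu := by
  have := SVT.finite_hasContent (cells := starCells lam mu) nu
  rw [cLR, mul_ne_zero_iff, Nat.cast_ne_zero, ← Nat.pos_iff_ne_zero, Nat.card_pos_iff,
    nonempty_subtype]
  simp [this]

section WeylInequality

variable {D : YoungDiagram} {E : ℕ × ℕ → Finset ℕ}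

/-- `E` is a semistandard set-valued filling of the straight shape `D`. -/
structure IsFilling (D : YoungDiagram) (E : ℕ × ℕ → Finset ℕ) : Prop where
  nonempty : ∀ c ∈ D.cells, (E c).Nonempty
  row_weak : ∀ i j, (i, j + 1) ∈ D → ∀ a ∈ E (i, j), ∀ b ∈ E (i, j + 1), a ≤ b
  col_strict : ∀ i j, (i + 1, j) ∈ D → ∀ a ∈ E (i, j), ∀ b ∈ E (i + 1, j), a < b

theorem IsFilling.row_le (h : IsFilling D E) {i j k a b : ℕ} (hD : (i, j + k) ∈ D)
    (hjk : 0 < k) (ha : a ∈ E (i, j)) (hb : b ∈ E (i, j + k)) : a ≤ b := by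
  induction k generalizing b with
  | zero => omega
  | succ k ih =>
    rcases Nat.eq_zero_or_pos k with rfl | hk
    · exact h.row_weak i j hD a ha b hb
    · have hD' : (i, j + k) ∈ D := D.up_left_mem le_rfl (by omega) hD
      obtain ⟨d, hd⟩ := h.nonempty _ hD'
      exact (ih hD' hk hd).trans (h.row_weak i (j + k) hD d hd b hb)

theorem IsFilling.col_lt (h : IsFilling D E) {i j k a b : ℕ} (hD : (i + (k + 1), j) ∈ D)
    (ha : a ∈ E (i, j)) (hb : b ∈ E (i + (k + 1), j)) : a < b := by
  induction k generalizing b with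
  | zero => exact h.col_strict i j hD a ha b hb
  | succ k ih =>
    have hD' : (i + (k + 1), j) ∈ D := D.up_left_mem (by omega) le_rfl hD
    obtain ⟨d, hd⟩ := h.nonempty _ hD'
    exact (ih hD' hd).trans (h.col_strict (i + (k + 1)) j hD d hd b hb)

theorem IsFilling.lt_of_lt (h : IsFilling D E) {i j i' j' a b : ℕ} (hD : (i', j') ∈ D)
    (hi : i < i') (hj : j ≤ j') (ha : a ∈ E (i, j)) (hb : b ∈ E (i', j')) : a < b := by
  obtain ⟨k, rfl⟩ : ∃ k, i' = i + (k + 1) := Nat.exists_eq_add_of_lt hi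
  rcases hj.eq_or_lt with rfl | hj
  · exact h.col_lt hD ha hb
  · obtain ⟨l, rfl⟩ : ∃ l, j' = j + (l + 1) := Nat.exists_eq_add_of_lt hj
    have hD' : (i, j + (l + 1)) ∈ D := D.up_left_mem (by omega) le_rfl hD
    obtain ⟨d, hd⟩ := h.nonempty _ hD'
    exact (h.row_le hD' (by omega) ha hd).trans_lt (h.col_lt hD hd hb)

theorem IsFilling.le_of_lt (h : IsFilling D E) {i j i' j' a b : ℕ} (hD : (i', j') ∈ D)
    (hi : i ≤ i') (hj : j < j') (ha : a ∈ E (i, j)) (hb : b ∈ E (i', j')) : a ≤ b := by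
  rcases hi.eq_or_lt with rfl | hi
  · obtain ⟨l, rfl⟩ : ∃ l, j' = j + (l + 1) := Nat.exists_eq_add_of_lt hj
    exact h.row_le hD (by omega) ha hb
  · exact (h.lt_of_lt hD hi hj.le ha hb).le

/-- The lattice condition for the column word of `E`, read after a word with content `K`. -/
def IsLatticeFrom (D : YoungDiagram) (E : ℕ × ℕ → Finset ℕ) (K : ℕ → ℕ) : Prop :=
  ∀ m q x, x + 1 ∈ E (m, q) → (m, q) ∈ D →
    K (x + 1) + #{c ∈ D.cells | x + 1 ∈ E c ∧ (q < c.2 ∨ q = c.2 ∧ c.1 ≤ m)} ≤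
      K x + #{c ∈ D.cells | x ∈ E c ∧ (q < c.2 ∨ q = c.2 ∧ c.1 < m)}

theorem monotone_filter_right_of_mem {α : Type*} {s : Finset α} {p q : α → Prop}
    [DecidablePred p] [DecidablePred q] (h : ∀ a ∈ s, p a → q a) : s.filter p ⊆ s.filter q := fun a ha => by
  rw [mem_filter] at ha ⊢
  exact ⟨ha.1, h a ha.1 ha.2⟩

theorem IsFilling.add_card_rows_lt_succ_le_of_exists (h : IsFilling D E) {K : ℕ → ℕ}
    (hl : IsLatticeFrom D E K) {m x : ℕ} (hex : ∃ q, (m, q) ∈ D ∧ x + 1 ∈ E (m, q)) :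
    K (x + 1) + #{c ∈ D.cells | x + 1 ∈ E c ∧ c.1 < m + 1} ≤
      K x + #{c ∈ D.cells | x ∈ E c ∧ c.1 < m} := by
  obtain ⟨hD, hx⟩ := Nat.find_spec hex
  refine (Nat.add_le_add_left (card_le_card ?_) _).trans
    ((hl m (Nat.find hex) x hx hD).trans (Nat.add_le_add_left (card_le_card ?_) _))
  · refine monotone_filter_right_of_mem ?_
    rintro ⟨a, b⟩ hc ⟨hxc, ha⟩
    refine ⟨hxc, ?_⟩
    by_contra hlt
    simp only at ha hlt
    rcases Nat.lt_or_ge a m with ham | ham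
    · exact absurd (h.lt_of_lt hD ham (by omega) hxc hx) (lt_irrefl _)
    · obtain rfl : a = m := by omega
      exact Nat.find_min hex (m := b) (by omega) ⟨hc, hxc⟩
  · refine monotone_filter_right_of_mem ?_
    rintro ⟨a, b⟩ hc ⟨hxc, hab⟩
    refine ⟨hxc, ?_⟩
    by_contra hlt
    simp only at hab hlt
    exact absurd (h.le_of_lt hc (by omega) (by omega) hx hxc) (by omega)

theorem IsFilling.add_card_rows_lt_succ_le (h : IsFilling D E) {K : ℕ → ℕ} (hK : Antitone K)
    (hl : IsLatticeFrom D E K) (m x : ℕ) :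
    K (x + 1) + #{c ∈ D.cells | x + 1 ∈ E c ∧ c.1 < m + 1} ≤
      K x + #{c ∈ D.cells | x ∈ E c ∧ c.1 < m} := by
  induction m with
  | zero =>
    by_cases hex : ∃ q, (0, q) ∈ D ∧ x + 1 ∈ E (0, q)
    · exact h.add_card_rows_lt_succ_le_of_exists hl hex
    · rw [card_eq_zero.2, add_zero]
      · exact (hK (Nat.le_succ x)).trans (Nat.le_add_right _ _)
      · refine filter_eq_empty_iff.2 ?_
        rintro ⟨a, b⟩ hD ⟨hx, ha⟩
        obtain rfl : a = 0 := by simpa using ha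
        exact hex ⟨b, hD, hx⟩
  | succ m ih =>
    by_cases hex : ∃ q, (m + 1, q) ∈ D ∧ x + 1 ∈ E (m + 1, q)
    · exact h.add_card_rows_lt_succ_le_of_exists hl hex
    · refine (Nat.add_le_add_left (card_le_card ?_) _).trans
        (ih.trans (Nat.add_le_add_left (card_le_card ?_) _))
      · refine monotone_filter_right_of_mem ?_
        rintro ⟨a, b⟩ hD ⟨hx, ha⟩
        refine ⟨hx, ?_⟩
        by_contra hlt
        obtain rfl : a = m + 1 := by simp only at ha hlt; omega
        exact hex ⟨b, hD, hx⟩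
      · refine monotone_filter_right_of_mem ?_
        rintro c - ⟨hx, hc⟩
        exact ⟨hx, by omega⟩

theorem IsFilling.add_card_rows_lt_le (h : IsFilling D E) {K : ℕ → ℕ} (hK : Antitone K)
    (hl : IsLatticeFrom D E K) (i j : ℕ) :
    K (i + j) + #{c ∈ D.cells | i + j ∈ E c ∧ c.1 < j} ≤ K i := by
  induction j with
  | zero => simp
  | succ j ih => exact (h.add_card_rows_lt_succ_le hK hl j (i + j)).trans ih

theorem IsFilling.card_rows_ge_le (h : IsFilling D E) (x j : ℕ) :
    #{c ∈ D.cells | x ∈ E c ∧ ¬ c.1 < j} ≤ D.rowLen j := by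
  rw [← card_range (D.rowLen j)]
  refine card_le_card_of_injOn Prod.snd ?_ ?_
  · rintro ⟨a, b⟩ hc
    simp only [coe_filter, Set.mem_ofPred_eq, YoungDiagram.mem_cells] at hc
    have : (j, b) ∈ D := D.up_left_mem (by omega) le_rfl hc.1
    simpa [YoungDiagram.mem_iff_lt_rowLen] using this
  · rintro ⟨a, b⟩ hc ⟨a', b'⟩ hc' heq
    simp only [coe_filter, Set.mem_ofPred_eq, YoungDiagram.mem_cells] at hc hc' heq
    subst heq
    rcases lt_trichotomy a a' with hlt | rfl | hlt
    · exact absurd (h.lt_of_lt hc'.1 hlt le_rfl hc.2.1 hc'.2.1) (lt_irrefl x)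
    · rfl
    · exact absurd (h.lt_of_lt hc.1 hlt le_rfl hc'.2.1 hc.2.1) (lt_irrefl x)

theorem IsFilling.add_card_le (h : IsFilling D E) {K : ℕ → ℕ} (hK : Antitone K)
    (hl : IsLatticeFrom D E K) (i j : ℕ) :
    K (i + j) + #{c ∈ D.cells | i + j ∈ E c} ≤ K i + D.rowLen j := by
  rw [← card_filter_add_card_filter_not (s := {c ∈ D.cells | i + j ∈ E c}) (fun c => c.1 < j),
    filter_filter, filter_filter, ← add_assoc]
  exact Nat.add_le_add (h.add_card_rows_lt_le hK hl i j) (h.card_rows_ge_le (i + j) j)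

end WeylInequality

section Star

variable {lam mu : YoungDiagram}

theorem mem_starCells_upper {c : ℕ × ℕ} (hc : c ∈ lam) :
    (c.1, c.2 + mu.rowLen 0) ∈ starCells lam mu :=
  mem_union_left _ (mem_image_of_mem _ hc)

theorem mem_starCells_lower {c : ℕ × ℕ} (hc : c ∈ mu) :
    (c.1 + lam.colLen 0, c.2) ∈ starCells lam mu :=
  mem_union_right _ (mem_image_of_mem _ hc)

theorem lt_colLen_zero_of_mem {D : YoungDiagram} {c : ℕ × ℕ} (hc : c ∈ D) :
    c.1 < D.colLen 0 :=
  YoungDiagram.mem_iff_lt_colLen.1 (D.up_left_mem le_rfl (Nat.zero_le c.2) hc)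

theorem lt_rowLen_zero_of_mem {D : YoungDiagram} {c : ℕ × ℕ} (hc : c ∈ D) :
    c.2 < D.rowLen 0 :=
  YoungDiagram.mem_iff_lt_rowLen.1 (D.up_left_mem (Nat.zero_le c.1) le_rfl hc)

theorem card_filter_starCells (P : ℕ × ℕ → Prop) [DecidablePred P] :
    #{c ∈ starCells lam mu | P c} = #{c ∈ lam.cells | P (c.1, c.2 + mu.rowLen 0)} +
      #{c ∈ mu.cells | P (c.1 + lam.colLen 0, c.2)} := by
  rw [starCells, filter_union, card_union_of_disjoint, filter_image, filter_image,
    card_image_of_injective, card_image_of_injective]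
  · rintro ⟨a, b⟩ ⟨a', b'⟩ h
    simpa using h
  · rintro ⟨a, b⟩ ⟨a', b'⟩ h
    simpa using h
  · refine disjoint_filter_filter (disjoint_left.2 ?_)
    simp only [mem_image, YoungDiagram.mem_cells]
    rintro _ ⟨c, -, rfl⟩ ⟨d, hd, h⟩
    have := lt_rowLen_zero_of_mem hd
    simp only [Prod.mk.injEq] at h
    omega

namespace SVT

variable (T : SVT (starCells lam mu))

theorem isFilling_upper :
    IsFilling lam fun c => T.entry (c.1, c.2 + mu.rowLen 0) where
  nonempty c hc := T.nonempty_of_mem _ (mem_starCells_upper hc)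
  row_weak i j hD := by
    have h := T.row_weak i (j + mu.rowLen 0)
      (mem_starCells_upper (c := (i, j)) (lam.up_left_mem le_rfl (Nat.le_succ j) hD))
    rw [Nat.add_right_comm] at h
    exact h (mem_starCells_upper hD)
  col_strict i j hD := T.col_strict i (j + mu.rowLen 0)
    (mem_starCells_upper (c := (i, j)) (lam.up_left_mem (Nat.le_succ i) le_rfl hD))
    (mem_starCells_upper hD)

theorem isFilling_lower :
    IsFilling mu fun c => T.entry (c.1 + lam.colLen 0, c.2) where
  nonempty c hc := T.nonempty_of_mem _ (mem_starCells_lower hc)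
  row_weak i j hD := T.row_weak (i + lam.colLen 0) j
    (mem_starCells_lower (c := (i, j)) (mu.up_left_mem le_rfl (Nat.le_succ j) hD))
    (mem_starCells_lower hD)
  col_strict i j hD := by
    have h := T.col_strict (i + lam.colLen 0) j
      (mem_starCells_lower (c := (i, j)) (mu.up_left_mem (Nat.le_succ i) le_rfl hD))
    rw [Nat.add_right_comm] at h
    exact h (mem_starCells_lower hD)

variable {T}

theorem card_upper_add_card_lower_le (hT : IsRLW T.word) {U : (ℕ × ℕ) × ℕ → Prop}
    (hU : IsFinalSegment U) (x : ℕ) :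
    #{c ∈ lam.cells | x + 1 ∈ T.entry (c.1, c.2 + mu.rowLen 0) ∧
        U ((c.1, c.2 + mu.rowLen 0), x + 1)} +
      #{c ∈ mu.cells | x + 1 ∈ T.entry (c.1 + lam.colLen 0, c.2) ∧
        U ((c.1 + lam.colLen 0, c.2), x + 1)} ≤
    #{c ∈ lam.cells | x ∈ T.entry (c.1, c.2 + mu.rowLen 0) ∧
        U ((c.1, c.2 + mu.rowLen 0), x)} +
      #{c ∈ mu.cells | x ∈ T.entry (c.1 + lam.colLen 0, c.2) ∧
        U ((c.1 + lam.colLen 0, c.2), x)} := by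
  simpa only [card_filter_starCells] using T.isRLW_word_iff.1 hT U hU x

theorem card_upper_le (hT : IsRLW T.word) {U : (ℕ × ℕ) × ℕ → Prop}
    (hU : IsFinalSegment U) (hcol : ∀ b, U b → mu.rowLen 0 ≤ b.1.2) (x : ℕ) :
    #{c ∈ lam.cells | x + 1 ∈ T.entry (c.1, c.2 + mu.rowLen 0) ∧
        U ((c.1, c.2 + mu.rowLen 0), x + 1)} ≤
    #{c ∈ lam.cells | x ∈ T.entry (c.1, c.2 + mu.rowLen 0) ∧
        U ((c.1, c.2 + mu.rowLen 0), x)} := by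
  have h := card_upper_add_card_lower_le hT hU x
  have h0 : #{c ∈ mu.cells | x ∈ T.entry (c.1 + lam.colLen 0, c.2) ∧
      U ((c.1 + lam.colLen 0, c.2), x)} = 0 := by
    rw [card_eq_zero, filter_eq_empty_iff]
    rintro c hc ⟨-, h⟩
    exact absurd (hcol _ h) (lt_rowLen_zero_of_mem (show c ∈ mu from hc)).not_ge
  omega

theorem isLatticeFrom_upper (hT : IsRLW T.word) :
    IsLatticeFrom lam (fun c => T.entry (c.1, c.2 + mu.rowLen 0)) fun _ => 0 := by
  intro m q x _ _
  have h := card_upper_le hT (isFinalSegment_readFrom ((m, q + mu.rowLen 0), x + 1)) ?_ x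
  · simp only [zero_add]
    refine (card_le_card ?_).trans (h.trans (card_le_card ?_))
    · refine monotone_filter_right_of_mem fun c _ hc => ⟨hc.1, ?_⟩
      have := hc.2
      simp only [ReadFrom, ReadBefore, Prod.mk.injEq, and_true]
      omega
    · refine monotone_filter_right_of_mem fun c _ hc => ⟨hc.1, ?_⟩
      have := hc.2
      simp only [ReadFrom, ReadBefore, Prod.mk.injEq] at this
      omega
  · rintro b (rfl | hb)
    · exact Nat.le_add_left _ _
    · simp only [ReadBefore] at hb
      omega

theorem antitone_card_upper (hT : IsRLW T.word) :
    Antitone fun x => #{c ∈ lam.cells | x ∈ T.entry (c.1, c.2 + mu.rowLen 0)} := by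
  refine antitone_nat_of_succ_le fun x => ?_
  simpa using card_upper_le hT (U := fun b => mu.rowLen 0 ≤ b.1.2)
    (fun a b hab ha => by simp only [ReadBefore] at *; omega) (fun _ => id) x

theorem isLatticeFrom_lower (hT : IsRLW T.word) :
    IsLatticeFrom mu (fun c => T.entry (c.1 + lam.colLen 0, c.2))
      fun x => #{c ∈ lam.cells | x ∈ T.entry (c.1, c.2 + mu.rowLen 0)} := by
  intro m q x _ hD
  have hq : q < mu.rowLen 0 := lt_rowLen_zero_of_mem hD
  refine (Nat.add_le_add (card_le_card ?_) (card_le_card ?_)).trans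
    ((card_upper_add_card_lower_le hT
      (isFinalSegment_readFrom ((m + lam.colLen 0, q), x + 1)) x).trans
      (Nat.add_le_add (card_le_card ?_) (card_le_card ?_)))
  · refine monotone_filter_right_of_mem fun c _ hc => ⟨hc, ?_⟩
    simp only [ReadFrom, ReadBefore, Prod.mk.injEq]
    omega
  · refine monotone_filter_right_of_mem fun c _ hc => ⟨hc.1, ?_⟩
    have := hc.2
    simp only [ReadFrom, ReadBefore, Prod.mk.injEq, and_true]
    omega
  · exact monotone_filter_right_of_mem fun c _ hc => hc.1
  · refine monotone_filter_right_of_mem fun c _ hc => ⟨hc.1, ?_⟩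
    have := hc.2
    simp only [ReadFrom, ReadBefore, Prod.mk.injEq] at this
    omega

/-- Weyl's inequality for contents of set-valued tableaux of shape `lam * mu`. -/
theorem rowLen_add_le {nu : YoungDiagram} (hT : IsRLW T.word) (hnu : HasContent T.word nu)
    (i j : ℕ) : nu.rowLen (i + j) ≤ lam.rowLen i + mu.rowLen j := by
  rw [← hnu, count_word_s18, card_filter_starCells]
  refine (T.isFilling_lower.add_card_le (antitone_card_upper hT) (isLatticeFrom_lower hT)
    i j).trans (Nat.add_le_add_right ?_ _)
  simpa using T.isFilling_upper.add_card_le (fun _ _ _ => le_rfl) (isLatticeFrom_upper hT) 0 i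

end SVT

/-- The height of column `p` of `lam`, cut off beyond the first `M` columns. -/
def cutColLen (lam : YoungDiagram) (M p : ℕ) : ℕ := if p < M then lam.colLen p else 0

theorem cutColLen_antitone (lam : YoungDiagram) (M : ℕ) : Antitone (cutColLen lam M) := by
  intro p p' hp
  unfold cutColLen
  split_ifs
  · exact lam.colLen_anti _ _ hp
  · omega
  · exact Nat.zero_le _
  · exact le_rfl

/-- The filling of `lam * mu` obtained by stacking column `M - 1 - p` of `mu` below column `p` of
`lam` for `p < M`, the boxes of the stacked columns recording the entries, and then sorting the
rows of `mu`. -/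
def stackedEntry (lam mu : YoungDiagram) (M : ℕ) (c : ℕ × ℕ) : ℕ :=
  if c.1 < lam.colLen 0 then c.1
  else (c.1 - lam.colLen 0) +
    cutColLen lam M (max (mu.rowLen (c.1 - lam.colLen 0)) M - 1 - c.2)

theorem stackedEntry_upper {c : ℕ × ℕ} (hc : c ∈ lam) (M : ℕ) :
    stackedEntry lam mu M (c.1, c.2 + mu.rowLen 0) = c.1 :=
  if_pos (lt_colLen_zero_of_mem hc)

theorem stackedEntry_lower (lam mu : YoungDiagram) (M m q : ℕ) :
    stackedEntry lam mu M (m + lam.colLen 0, q) =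
      m + cutColLen lam M (max (mu.rowLen m) M - 1 - q) := by
  simp [stackedEntry]

theorem mem_starCells {c : ℕ × ℕ} :
    c ∈ starCells lam mu ↔ (∃ d ∈ lam, (d.1, d.2 + mu.rowLen 0) = c) ∨
      ∃ d ∈ mu, (d.1 + lam.colLen 0, d.2) = c := by
  simp only [starCells, mem_union, mem_image, YoungDiagram.mem_cells]

/-- The tableau with entries `stackedEntry`. -/
def stackedTableau (lam mu : YoungDiagram) (M : ℕ) : SVT (starCells lam mu) where
  entry c := if c ∈ starCells lam mu then {stackedEntry lam mu M c} else ∅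
  nonempty_of_mem c hc := by simp [hc]
  eq_empty_of_not_mem c hc := by simp [hc]
  row_weak i j h1 h2 a ha b hb := by
    simp only [h1, h2, if_true, mem_singleton] at ha hb
    subst ha hb
    unfold stackedEntry
    split_ifs
    · exact le_rfl
    · exact Nat.add_le_add_left (cutColLen_antitone _ _ (by simp only; omega)) _
  col_strict i j h1 h2 a ha b hb := by
    simp only [h1, h2, if_true, mem_singleton] at ha hb
    subst ha hb
    rcases mem_starCells.1 h1 with ⟨d, hd, h⟩ | ⟨d, hd, h⟩ <;>
    rcases mem_starCells.1 h2 with ⟨d', hd', h'⟩ | ⟨d', hd', h'⟩ <;>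
    rw [← h, ← h'] <;> simp only [Prod.mk.injEq] at h h'
    · rw [stackedEntry_upper hd, stackedEntry_upper hd']
      omega
    · have := lt_rowLen_zero_of_mem hd'
      omega
    · have := lt_colLen_zero_of_mem hd'
      omega
    · rw [stackedEntry_lower, stackedEntry_lower]
      have hm : d.1 < d'.1 := by omega
      have := mu.rowLen_anti _ _ hm.le
      have := cutColLen_antitone lam M
        (show max (mu.rowLen d'.1) M - 1 - d'.2 ≤ max (mu.rowLen d.1) M - 1 - d.2 by omega)
      omega

theorem mem_stackedTableau_entry {M x : ℕ} {c : ℕ × ℕ} :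
    x ∈ (stackedTableau lam mu M).entry c ↔
      c ∈ starCells lam mu ∧ stackedEntry lam mu M c = x := by
  simp only [stackedTableau]
  split_ifs with h <;> simp [h, eq_comm]

theorem count_stackedTableau (M x : ℕ) :
    (stackedTableau lam mu M).word.count x =
      #{c ∈ starCells lam mu | stackedEntry lam mu M c = x} := by
  rw [SVT.count_word_s18]
  congr 1
  refine filter_congr fun c hc => ?_
  simp [mem_stackedTableau_entry, hc]

/-- The box directly above `c` in its stacked column. -/
def stackedAbove (lam mu : YoungDiagram) (M : ℕ) (c : ℕ × ℕ) : ℕ × ℕ :=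
  if c.1 < lam.colLen 0 then (c.1 - 1, c.2)
  else if c.1 = lam.colLen 0 then
    (stackedEntry lam mu M c - 1, max (mu.rowLen 0) M - 1 - c.2 + mu.rowLen 0)
  else (c.1 - 1, max (mu.rowLen (c.1 - 1 - lam.colLen 0)) M - 1 -
    (max (mu.rowLen (c.1 - lam.colLen 0)) M - 1 - c.2))

theorem stackedAbove_upper {c : ℕ × ℕ} (hc : c ∈ lam) (M : ℕ) :
    stackedAbove lam mu M (c.1, c.2 + mu.rowLen 0) = (c.1 - 1, c.2 + mu.rowLen 0) :=
  if_pos (lt_colLen_zero_of_mem hc)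

theorem stackedAbove_lower_zero (lam mu : YoungDiagram) (M q : ℕ) :
    stackedAbove lam mu M (0 + lam.colLen 0, q) =
      (cutColLen lam M (max (mu.rowLen 0) M - 1 - q) - 1,
        max (mu.rowLen 0) M - 1 - q + mu.rowLen 0) := by
  have := stackedEntry_lower lam mu M 0 q
  simp only [zero_add] at *
  simp [stackedAbove, this]

theorem stackedAbove_lower_succ (lam mu : YoungDiagram) (M m q : ℕ) :
    stackedAbove lam mu M (m + 1 + lam.colLen 0, q) =
      (m + lam.colLen 0, max (mu.rowLen m) M - 1 - (max (mu.rowLen (m + 1)) M - 1 - q)) := by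
  have h1 : m + 1 + lam.colLen 0 - 1 = m + lam.colLen 0 := by omega
  simp [stackedAbove, h1]

theorem cutColLen_eq_succ {M p x : ℕ} (h : cutColLen lam M p = x + 1) :
    (x, p) ∈ lam ∧ (x + 1, p) ∉ lam := by
  unfold cutColLen at h
  split_ifs at h
  rw [YoungDiagram.mem_iff_lt_colLen, YoungDiagram.mem_iff_lt_colLen]
  omega

theorem stackedAbove_spec {M x : ℕ} {c : ℕ × ℕ} (hc : c ∈ starCells lam mu)
    (hx : stackedEntry lam mu M c = x + 1) :
    stackedAbove lam mu M c ∈ starCells lam mu ∧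
      stackedEntry lam mu M (stackedAbove lam mu M c) = x ∧
      ReadBefore (c, x + 1) (stackedAbove lam mu M c, x) := by
  rcases mem_starCells.1 hc with ⟨⟨i, p⟩, hd, rfl⟩ | ⟨⟨m, q⟩, hd, rfl⟩
  · rw [stackedEntry_upper hd] at hx
    rw [stackedAbove_upper hd]
    simp only at hx
    subst hx
    have hd' : (x, p) ∈ lam := lam.up_left_mem (Nat.le_succ x) le_rfl hd
    exact ⟨mem_starCells_upper hd', stackedEntry_upper hd' M,
      Or.inr ⟨rfl, Or.inl (Nat.lt_succ_self x)⟩⟩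
  · have hq := YoungDiagram.mem_iff_lt_rowLen.1 hd
    rw [stackedEntry_lower] at hx
    simp only at hx ⊢
    rcases m with _ | m
    · rw [zero_add] at hx
      have hd' := (cutColLen_eq_succ hx).1
      rw [stackedAbove_lower_zero, hx, Nat.add_sub_cancel]
      refine ⟨mem_starCells_upper hd', stackedEntry_upper hd' M, Or.inl ?_⟩
      simp only
      omega
    · have hm := mu.rowLen_anti m (m + 1) (Nat.le_succ m)
      rw [stackedAbove_lower_succ]
      refine ⟨mem_starCells_lower (c := (m, _)) ?_, ?_, ?_⟩
      · rw [YoungDiagram.mem_iff_lt_rowLen]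
        omega
      · rw [stackedEntry_lower,
          show max (mu.rowLen m) M - 1 - (max (mu.rowLen m) M - 1 -
            (max (mu.rowLen (m + 1)) M - 1 - q)) = max (mu.rowLen (m + 1)) M - 1 - q by omega]
        omega
      · simp only [ReadBefore]
        omega

theorem stackedAbove_upper_ne_lower {M x : ℕ} {c d : ℕ × ℕ} (hc : c ∈ lam) (hd : d ∈ mu)
    (hcx : stackedEntry lam mu M (c.1, c.2 + mu.rowLen 0) = x + 1)
    (hdx : stackedEntry lam mu M (d.1 + lam.colLen 0, d.2) = x + 1) :
    stackedAbove lam mu M (c.1, c.2 + mu.rowLen 0) ≠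
      stackedAbove lam mu M (d.1 + lam.colLen 0, d.2) := by
  obtain ⟨i, p⟩ := c
  obtain ⟨m, q⟩ := d
  intro heq
  rw [stackedEntry_upper hc] at hcx
  rw [stackedEntry_lower] at hdx
  rw [stackedAbove_upper hc] at heq
  have hi := lt_colLen_zero_of_mem hc
  simp only at hcx hi
  subst hcx
  rcases m with _ | m
  · rw [zero_add] at hdx
    simp only [stackedAbove_lower_zero, Prod.mk.injEq] at heq
    rw [show max (mu.rowLen 0) M - 1 - q = p by omega] at hdx
    exact (cutColLen_eq_succ hdx).2 hc
  · simp only [stackedAbove_lower_succ, Prod.mk.injEq] at heq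
    omega

theorem stackedAbove_injOn (lam mu : YoungDiagram) (M x : ℕ) :
    Set.InjOn (stackedAbove lam mu M)
      {c | c ∈ starCells lam mu ∧ stackedEntry lam mu M c = x + 1} := by
  rintro c ⟨hc, hx⟩ c' ⟨hc', hx'⟩ heq
  rcases mem_starCells.1 hc with ⟨⟨i, p⟩, hd, rfl⟩ | ⟨⟨m, q⟩, hd, rfl⟩ <;>
  rcases mem_starCells.1 hc' with ⟨⟨i', p'⟩, hd', rfl⟩ | ⟨⟨m', q'⟩, hd', rfl⟩
  · rw [stackedEntry_upper hd] at hx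
    rw [stackedEntry_upper hd'] at hx'
    rw [stackedAbove_upper hd, stackedAbove_upper hd'] at heq
    simp only [Prod.mk.injEq] at *
    omega
  · exact absurd heq (stackedAbove_upper_ne_lower hd hd' hx hx')
  · exact absurd heq.symm (stackedAbove_upper_ne_lower hd' hd hx' hx)
  · have hq := YoungDiagram.mem_iff_lt_rowLen.1 hd
    have hq' := YoungDiagram.mem_iff_lt_rowLen.1 hd'
    rw [stackedEntry_lower] at hx hx'
    simp only at hx hx'
    rcases m with _ | m <;> rcases m' with _ | m'
    · simp only [stackedAbove_lower_zero, Prod.mk.injEq] at heq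
      simp only [Prod.mk.injEq, true_and]
      omega
    · rw [zero_add] at hx
      have : x < lam.colLen 0 := lt_colLen_zero_of_mem (cutColLen_eq_succ hx).1
      simp only [stackedAbove_lower_zero, stackedAbove_lower_succ, Prod.mk.injEq] at heq
      omega
    · rw [zero_add] at hx'
      have : x < lam.colLen 0 := lt_colLen_zero_of_mem (cutColLen_eq_succ hx').1
      simp only [stackedAbove_lower_zero, stackedAbove_lower_succ, Prod.mk.injEq] at heq
      omega
    · have hm := mu.rowLen_anti m (m + 1) (Nat.le_succ m)
      simp only [stackedAbove_lower_succ, Prod.mk.injEq] at heq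
      obtain rfl : m = m' := by omega
      simp only [Prod.mk.injEq, true_and]
      omega

theorem isRLW_stackedTableau (lam mu : YoungDiagram) (M : ℕ) :
    IsRLW (stackedTableau lam mu M).word := by
  rw [SVT.isRLW_word_iff]
  intro U hU x
  refine card_le_card_of_injOn (stackedAbove lam mu M) ?_
    ((stackedAbove_injOn lam mu M x).mono ?_)
  · intro c hc
    simp only [coe_filter, Set.mem_ofPred_eq, mem_stackedTableau_entry] at hc ⊢
    obtain ⟨h1, h2, h3⟩ := stackedAbove_spec hc.1 hc.2.1.2
    exact ⟨h1, ⟨h1, h2⟩, hU _ _ h3 hc.2.2⟩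
  · intro c hc
    simp only [coe_filter, Set.mem_ofPred_eq, mem_stackedTableau_entry] at hc ⊢
    exact hc.2.1

theorem le_count_stackedTableau {M r : ℕ}
    (hM : ∀ i j, i + j = r → M ≤ lam.rowLen i + mu.rowLen j) :
    M ≤ (stackedTableau lam mu M).word.count r := by
  rw [count_stackedTableau, ← card_range M]
  refine card_le_card_of_injOn (fun p => if r < lam.colLen p then (r, p + mu.rowLen 0) else
    (r - lam.colLen p + lam.colLen 0, max (mu.rowLen (r - lam.colLen p)) M - 1 - p)) ?_ ?_
  · intro p hp
    have hp' : p < M := by simpa using hp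
    simp only [coe_filter, Set.mem_ofPred_eq, card_range]
    split_ifs with hr
    · have hd : (r, p) ∈ lam := YoungDiagram.mem_iff_lt_colLen.2 hr
      exact ⟨mem_starCells_upper hd, stackedEntry_upper hd _⟩
    · have h1 := hM (lam.colLen p) (r - lam.colLen p) (by omega)
      have h2 : ¬ p < lam.rowLen (lam.colLen p) := by
        rw [← YoungDiagram.mem_iff_lt_rowLen, YoungDiagram.mem_iff_lt_colLen]
        exact lt_irrefl _
      refine ⟨mem_starCells_lower (c := (r - lam.colLen p, _)) ?_, ?_⟩
      · rw [YoungDiagram.mem_iff_lt_rowLen]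
        omega
      · rw [stackedEntry_lower,
          show max (mu.rowLen (r - lam.colLen p)) M - 1 -
            (max (mu.rowLen (r - lam.colLen p)) M - 1 - p) = p by omega, cutColLen, if_pos hp']
        omega
  · intro p hp p' hp' heq
    have h1 : p < M := by simpa using hp
    have h2 : p' < M := by simpa using hp'
    simp only at heq
    split_ifs at heq with h3 h4 h4 <;> simp only [Prod.mk.injEq] at heq
    · omega
    · have := lam.colLen_anti _ _ (Nat.zero_le p)
      omega
    · have := lam.colLen_anti _ _ (Nat.zero_le p')
      omega
    · have h5 : r - lam.colLen p = r - lam.colLen p' := by omega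
      rw [h5] at heq
      omega

end Star

theorem exists_rowLen_eq {f : ℕ → ℕ} (hf : Antitone f) {N : ℕ} (hN : f N = 0) :
    ∃ D : YoungDiagram, ∀ i, D.rowLen i = f i := by
  let D : YoungDiagram := ⟨{c ∈ range N ×ˢ range (f 0) | c.2 < f c.1}, by
    rintro ⟨a, b⟩ ⟨a', b'⟩ ⟨ha, hb⟩ hc
    simp only [coe_filter, mem_product, mem_range, Set.mem_ofPred_eq] at *
    have := hf ha
    omega⟩
  refine ⟨D, fun i => ?_⟩
  have key : ∀ j, j < D.rowLen i ↔ j < f i := by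
    intro j
    rw [← YoungDiagram.mem_iff_lt_rowLen, ← YoungDiagram.mem_cells]
    simp only [D, mem_filter, mem_product, mem_range]
    refine ⟨fun h => h.2, fun h => ⟨⟨?_, h.trans_le (hf (Nat.zero_le i))⟩, h⟩⟩
    by_contra hi
    have := hf (not_lt.1 hi)
    omega
  exact le_antisymm (not_lt.1 fun h => lt_irrefl _ ((key _).1 h))
    (not_lt.1 fun h => lt_irrefl _ ((key _).2 h))

theorem exists_hasContent_stackedTableau (lam mu : YoungDiagram) (M : ℕ) :
    ∃ rho : YoungDiagram, HasContent (stackedTableau lam mu M).word rho ∧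
      rho.card = lam.card + mu.card := by
  obtain ⟨rho, hrho⟩ := exists_rowLen_eq (f := (stackedTableau lam mu M).word.count)
    (N := (starCells lam mu).sup (stackedEntry lam mu M) + 1)
    (antitone_nat_of_succ_le (isRLW_stackedTableau lam mu M _ List.suffix_rfl)) (by
      rw [count_stackedTableau, card_eq_zero, filter_eq_empty_iff]
      intro c hc h
      have := le_sup (f := stackedEntry lam mu M) hc
      omega)
  refine ⟨rho, fun i => (hrho i).symm, ?_⟩
  have hstar : #(starCells lam mu) = lam.card + mu.card := by
    simpa using card_filter_starCells (lam := lam) (mu := mu) (fun _ => True)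
  have hle : ∀ c ∈ starCells lam mu,
      stackedEntry lam mu M c < (starCells lam mu).sup (stackedEntry lam mu M) + 1 :=
    fun c hc => Nat.lt_succ_of_le (le_sup hc)
  set N := (starCells lam mu).sup (stackedEntry lam mu M) + 1
  rw [← hstar, YoungDiagram.card,
    card_eq_sum_card_fiberwise (f := Prod.fst) (t := range (max N (rho.colLen 0))),
    card_eq_sum_card_fiberwise (f := stackedEntry lam mu M) (t := range (max N (rho.colLen 0)))]
  · refine sum_congr rfl fun i _ => ?_
    rw [← count_stackedTableau, ← hrho, YoungDiagram.rowLen_eq_card]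
    rfl
  · intro c hc
    have := hle c hc
    simp only [coe_range, Set.mem_Iio]
    omega
  · intro c hc
    have := lt_colLen_zero_of_mem (show c ∈ rho from hc)
    simp only [coe_range, Set.mem_Iio]
    omega

end TableauWords

/-- **Support bound for the structure constants** (Proposition 7.7): if
`c^ν_{λμ} ≠ 0`, then every box of `ν` lies in some partition `ρ` with
`|ρ| = |λ| + |μ|` and `c^ρ_{λμ} ≠ 0` (a classical Littlewood–Richardson
coefficient). -/
theorem cLR_support_bound (lam mu nu : YoungDiagram) (h : cLR lam mu nu ≠ 0) :
    ∀ c ∈ nu.cells, ∃ rho : YoungDiagram,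
      rho.card = lam.card + mu.card ∧ cLR lam mu rho ≠ 0 ∧ c ∈ rho.cells := by
  rintro ⟨r, s⟩ hc
  obtain ⟨T, hT, hnu⟩ := cLR_ne_zero_iff.1 h
  obtain ⟨rho, hcontent, hcard⟩ := exists_hasContent_stackedTableau lam mu (nu.rowLen r)
  refine ⟨rho, hcard, cLR_ne_zero_iff.2 ⟨_, isRLW_stackedTableau _ _ _, hcontent⟩, ?_⟩
  rw [YoungDiagram.mem_cells, YoungDiagram.mem_iff_lt_rowLen] at hc ⊢
  rw [← hcontent]
  refine hc.trans_le (le_count_stackedTableau ?_)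
  rintro i j rfl
  exact SVT.rowLen_add_le hT hnu i j
end
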